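/- arXiv:2302.02061 — 7 statements merged into one kernel-verified Lean document; each statement's English description precedes it below -/
import Mathlib

section
/- Let n ≥ 2 be an integer, let Q ∈ ℝ^n be nondecreasing (Q_1 ≤ Q_2 ≤ … ≤ Q_n), and let l, u ∈ ℝ^n with l_i < u_i for every i. Define f(x) = Σ_{i=1}^n w_i(x) Q_i for x ∈ ℝ^n. Then there exists k ∈ {1,…,n−1} such that, setting t = (Q_k + Q_{k+1})/2 and defining x* ∈ ℝ^n by x*_i = l_i if Q_i < t and x*_i = u_i otherwise, the point x* maximizes f over the box Π_{i=1}^n [l_i, u_i], i.e. f(x*) ≥ f(x) for every x with l_i ≤ x_i ≤ u_i for all i. -/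
open Finset

/-- Softmax weight `w i x = exp (x i) / ∑ j, exp (x j)`. -/
noncomputable def softmaxWeight {n : ℕ} (x : Fin n → ℝ) (i : Fin n) : ℝ :=
  Real.exp (x i) / ∑ j, Real.exp (x j)

/-- The excess of the softmax average over `c`, up to the positive normalizing factor. -/
theorem sum_softmaxWeight_mul_sub {n : ℕ} [NeZero n] (x Q : Fin n → ℝ) (c : ℝ) :
    (∑ i, softmaxWeight x i * Q i - c) * ∑ j, Real.exp (x j) =
      ∑ i, Real.exp (x i) * (Q i - c) := by
  have hS : 0 < ∑ j, Real.exp (x j) := sum_pos (fun _ _ => Real.exp_pos _) univ_nonempty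
  have h : (∑ i, softmaxWeight x i * Q i) * ∑ j, Real.exp (x j) = ∑ i, Real.exp (x i) * Q i := by
    rw [sum_mul]
    refine sum_congr rfl fun i _ => ?_
    unfold softmaxWeight
    field_simp
  simp only [sub_mul, h, mul_sub, sum_sub_distrib, ← sum_mul]
  ring

theorem le_sum_softmaxWeight_iff {n : ℕ} [NeZero n] (x Q : Fin n → ℝ) (c : ℝ) :
    c ≤ ∑ i, softmaxWeight x i * Q i ↔ 0 ≤ ∑ i, Real.exp (x i) * (Q i - c) := by
  have hS : 0 < ∑ j, Real.exp (x j) := sum_pos (fun _ _ => Real.exp_pos _) univ_nonempty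
  rw [← sum_softmaxWeight_mul_sub, mul_nonneg_iff_of_pos_right hS, sub_nonneg]

theorem continuous_sum_softmaxWeight {n : ℕ} [NeZero n] (Q : Fin n → ℝ) :
    Continuous fun x : Fin n → ℝ => ∑ i, softmaxWeight x i * Q i := by
  unfold softmaxWeight
  refine continuous_finsetSum _ fun i _ => Continuous.mul (Continuous.div ?_ ?_ ?_) ?_
  · fun_prop
  · fun_prop
  · exact fun x => (sum_pos (fun _ _ => Real.exp_pos _) univ_nonempty).ne'
  · fun_prop

/-- **Threshold Optimism.** For nondecreasing `Q` and a box `∏ [l i, u i]` with `l i < u i`,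
the softmax-weighted average `f x = ∑ i, w i x * Q i` attains its maximum over the box at one of
the `n - 1` threshold configurations determined by midpoints of consecutive entries of `Q`. -/
theorem threshold_optimism (n : ℕ) (hn : 2 ≤ n) (Q l u : Fin n → ℝ)
    (hQ : Monotone Q) (hlu : ∀ i, l i < u i) :
    ∃ k : ℕ, ∃ hk : k + 1 < n,
      ∀ x : Fin n → ℝ, (∀ i, l i ≤ x i ∧ x i ≤ u i) →
        ∑ i, softmaxWeight x i * Q i ≤
          ∑ i, softmaxWeight
            (fun i => if Q i < (Q ⟨k, by omega⟩ + Q ⟨k + 1, hk⟩) / 2 then l i else u i) i * Q i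
    := by
  have : NeZero n := ⟨by omega⟩
  obtain ⟨y, hy, hmax⟩ := (isCompact_Icc (a := l) (b := u)).exists_isMaxOn
    ⟨l, le_rfl, fun i => (hlu i).le⟩ (continuous_sum_softmaxWeight Q).continuousOn
  set v := ∑ i, softmaxWeight y i * Q i with hv
  suffices h : ∃ k : ℕ, ∃ hk : k + 1 < n, v ≤ ∑ i, softmaxWeight
      (fun i => if Q i < (Q ⟨k, by omega⟩ + Q ⟨k + 1, hk⟩) / 2 then l i else u i) i * Q i by
    obtain ⟨k, hk, h⟩ := h
    exact ⟨k, hk, fun x hx => (hmax ⟨fun i => (hx i).1, fun i => (hx i).2⟩).trans h⟩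
  have hzero : ∑ i, Real.exp (y i) * (Q i - v) = 0 := by
    rw [← sum_softmaxWeight_mul_sub, ← hv, sub_self, zero_mul]
  have hex : ∃ m : ℕ, ∃ hm : m < n, v ≤ Q ⟨m, hm⟩ := by
    by_contra! h
    have : ∑ i, Real.exp (y i) * (Q i - v) < 0 :=
      sum_neg (fun i _ => mul_neg_of_pos_of_neg (Real.exp_pos _) (sub_neg.2 (h i i.2)))
        univ_nonempty
    exact this.ne hzero
  classical
  obtain ⟨hm, hvm⟩ := Nat.find_spec hex
  have hmin := fun j => Nat.find_min (m := j) hex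
  generalize Nat.find hex = m at hm hvm hmin
  cases m with
  | zero =>
    refine ⟨0, by omega, (le_sum_softmaxWeight_iff _ _ _).2 (sum_nonneg fun i _ => ?_)⟩
    exact mul_nonneg (Real.exp_pos _).le
      (sub_nonneg.2 (hvm.trans (hQ (Fin.mk_le_of_le_val (Nat.zero_le _)))))
  | succ k =>
    refine ⟨k, hm, (le_sum_softmaxWeight_iff _ _ _).2 (hzero.ge.trans (sum_le_sum fun i _ => ?_))⟩
    have hkv : Q ⟨k, by omega⟩ < v := by
      by_contra! h
      exact hmin k (Nat.lt_succ_self k) ⟨by omega, h⟩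
    rcases Nat.lt_or_ge k i with hi | hi
    · have hQi : Q ⟨k + 1, hm⟩ ≤ Q i := hQ (Fin.mk_le_of_le_val hi)
      rw [if_neg (by linarith)]
      exact mul_le_mul_of_nonneg_right (Real.exp_le_exp.2 (hy.2 i)) (by linarith)
    · have hQi : Q i ≤ Q ⟨k, by omega⟩ := hQ (Fin.le_def.2 hi)
      rw [if_pos (by linarith)]
      exact mul_le_mul_of_nonpos_right (Real.exp_le_exp.2 (hy.1 i)) (by linarith)
end

section
/- Let n ≥ 1 be an integer, Q ∈ ℝ^n, and l, u ∈ ℝ^n with l_i ≤ u_i for every i. Define f(x) = Σ_{i=1}^n w_i(x) Q_i for x ∈ ℝ^n. Then there exists x* ∈ ℝ^n with x*_i ∈ {l_i, u_i} for every i such that f(x*) ≥ f(x) for every x with l_i ≤ x_i ≤ u_i for all i; that is, the maximum of f over the box Π_{i=1}^n [l_i, u_i] is attained at an extreme point of the box. -/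
open Finset

lemma sum_softmaxWeight_mul_le_iff {n : ℕ} (hn : 1 ≤ n) (x Q : Fin n → ℝ) (M : ℝ) :
    ∑ i, softmaxWeight x i * Q i ≤ M ↔ ∑ i, Real.exp (x i) * (Q i - M) ≤ 0 := by
  have : Nonempty (Fin n) := ⟨⟨0, hn⟩⟩
  have hpos : 0 < ∑ j, Real.exp (x j) :=
    Finset.sum_pos (fun j _ => Real.exp_pos (x j)) Finset.univ_nonempty
  simp only [softmaxWeight, div_mul_eq_mul_div]
  rw [← Finset.sum_div, div_le_iff₀ hpos]
  simp only [mul_sub, Finset.sum_sub_distrib, ← Finset.sum_mul]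
  rw [sub_nonpos, mul_comm M]

/-- The softmax-weighted average `f x = ∑ i, w i x * Q i`, maximized over a rectangular box of
logits `∏ [l i, u i]`, attains its maximum at an extreme point of the box. -/
theorem softmax_average_max_at_extreme_point (n : ℕ) (hn : 1 ≤ n) (Q l u : Fin n → ℝ)
    (hlu : ∀ i, l i ≤ u i) :
    ∃ xstar : Fin n → ℝ, (∀ i, xstar i = l i ∨ xstar i = u i) ∧
      ∀ x : Fin n → ℝ, (∀ i, l i ≤ x i ∧ x i ≤ u i) →
        ∑ i, softmaxWeight x i * Q i ≤ ∑ i, softmaxWeight xstar i * Q i := by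
  obtain ⟨b, hb⟩ := Finite.exists_max fun b : Fin n → Bool =>
    ∑ i, softmaxWeight (fun j => if b j then u j else l j) i * Q i
  refine ⟨fun j => if b j then u j else l j, fun i => by cases h : b i <;> simp [h],
    fun x hx => ?_⟩
  set M := ∑ i, softmaxWeight (fun j => if b j then u j else l j) i * Q i
  have hy := (sum_softmaxWeight_mul_le_iff hn _ Q M).1 (hb fun i => decide (M ≤ Q i))
  refine (sum_softmaxWeight_mul_le_iff hn x Q M).2 (le_trans (Finset.sum_le_sum fun i _ => ?_) hy)
  by_cases h : M ≤ Q i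
  · simpa [h] using
      mul_le_mul_of_nonneg_right (Real.exp_le_exp.2 (hx i).2) (sub_nonneg.2 h)
  · simpa [h] using
      mul_le_mul_of_nonpos_right (Real.exp_le_exp.2 (hx i).1) (sub_nonpos.2 (not_le.1 h).le)
end

section
/- Let S and A be finite nonempty sets, H ≥ 1 an integer, and C ∈ ℝ. Let r' : {1,…,H} × S × A → ℝ, let P' : {1,…,H} × S × A → (S → ℝ) assign to each (h,s,a) a probability vector on S, and let π : {1,…,H} × S → (A → ℝ) assign to each (h,s) a probability vector on A. Define the truncated values by backward recursion: V^C_{H+1}(s) = 0 and, for h ∈ {1,…,H}, V^C_h(s) = Σ_{a∈A} π_h(s)(a) · min{C, r'_h(s,a) + Σ_{s'∈S} P'_h(s,a)(s') V^C_{h+1}(s')}. Define modified rewards r̄_h(s,a) = r'_h(s,a) − max{0, r'_h(s,a) + Σ_{s'∈S} P'_h(s,a)(s') V^C_{h+1}(s') − C}, and define V̄ by the untruncated backward recursion V̄_{H+1}(s) = 0 and V̄_h(s) = Σ_{a∈A} π_h(s)(a) · (r̄_h(s,a) + Σ_{s'∈S} P'_h(s,a)(s') V̄_{h+1}(s')).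 Then r̄_h(s,a) ≤ r'_h(s,a) for all h, s, a, and V̄_h(s) = V^C_h(s) for all h ∈ {1,…,H+1} and all s ∈ S. -/
open Finset

/-- The `C`-truncated value of a policy, defined by backward dynamic programming in which each
Bellman backup is clipped at level `C`, equals the ordinary (untruncated) value of the same
policy in the MDP with the same transitions but rewards reduced by the clipping excess; moreover
the modified rewards are pointwise no larger than the original ones. -/
theorem truncated_value_eq_modified_reward_value
    {S A : Type*} [Fintype S] [Fintype A] [Nonempty S] [Nonempty A]
    (H : ℕ) (hH : 1 ≤ H) (C : ℝ)
    (r' : ℕ → S → A → ℝ) (P' : ℕ → S → A → S → ℝ) (pol : ℕ → S → A → ℝ)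
    (hP'nonneg : ∀ h s a s', 1 ≤ h → h ≤ H → 0 ≤ P' h s a s')
    (hP'sum : ∀ h s a, 1 ≤ h → h ≤ H → ∑ s', P' h s a s' = 1)
    (hpolnonneg : ∀ h s a, 1 ≤ h → h ≤ H → 0 ≤ pol h s a)
    (hpolsum : ∀ h s, 1 ≤ h → h ≤ H → ∑ a, pol h s a = 1)
    (VC Vbar : ℕ → S → ℝ)
    (hVCend : ∀ s, VC (H + 1) s = 0)
    (hVC : ∀ h, 1 ≤ h → h ≤ H → ∀ s,
      VC h s = ∑ a, pol h s a * min C (r' h s a + ∑ s', P' h s a s' * VC (h + 1) s'))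
    (hVbarend : ∀ s, Vbar (H + 1) s = 0)
    (hVbar : ∀ h, 1 ≤ h → h ≤ H → ∀ s,
      Vbar h s = ∑ a, pol h s a *
        ((r' h s a - max 0 (r' h s a + (∑ s', P' h s a s' * VC (h + 1) s') - C)) +
          ∑ s', P' h s a s' * Vbar (h + 1) s')) :
    (∀ h s a, 1 ≤ h → h ≤ H →
      r' h s a - max 0 (r' h s a + (∑ s', P' h s a s' * VC (h + 1) s') - C) ≤ r' h s a) ∧
    (∀ h, 1 ≤ h → h ≤ H + 1 → ∀ s, Vbar h s = VC h s) := by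
  refine ⟨fun h s a _ _ => sub_le_self _ (le_max_left _ _), fun h h1 hle => ?_⟩
  induction hle using Nat.decreasingInduction with
  | self => intro s; rw [hVbarend, hVCend]
  | of_succ k hk ih =>
    intro s
    have hkH : k ≤ H := Nat.lt_succ_iff.mp hk
    rw [hVbar k h1 hkH, hVC k h1 hkH]
    refine Finset.sum_congr rfl fun a _ => ?_
    simp only [ih (Nat.le_add_left 1 k)]
    congr 1
    grind
end

section
/- Let S and A be finite nonempty sets, H ≥ 1 an integer, and C ∈ ℝ. Let r, r' : {1,…,H} × S × A → ℝ, let P, P' : {1,…,H} × S × A → (S → ℝ) assign to each (h,s,a) a probability vector on S, and let π : {1,…,H} × S → (A → ℝ) assign to each (h,s) a probability vector on A. Define the truncated values under (P', r') by V^C_{H+1}(s) = 0 and V^C_h(s) = Σ_{a} π_h(s)(a) · min{C, r'_h(s,a) + Σ_{s'} P'_h(s,a)(s') V^C_{h+1}(s')}; define the untruncated values under (P, r) by V_{H+1}(s) = 0 and V_h(s) = Σ_{a} π_h(s)(a) · (r_h(s,a) + Σ_{s'} P_h(s,a)(s') V_{h+1}(s')); and define W by W_{H+1}(s) = 0 and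 W_h(s) = Σ_{a} π_h(s)(a) · ( r'_h(s,a) − r_h(s,a) + Σ_{s'} (P'_h(s,a)(s') − P_h(s,a)(s')) V^C_{h+1}(s') + Σ_{s'} P_h(s,a)(s') W_{h+1}(s') ). Then V^C_h(s) − V_h(s) ≤ W_h(s) for every h ∈ {1,…,H+1} and s ∈ S. -/
open Finset

/-- **Truncated value difference lemma.** For a fixed policy, the gap between the `C`-truncated
value under the MDP `(P', r')` and the ordinary value under the MDP `(P, r)` is upper bounded by
the backward recursion `W` accumulating, under dynamics `P`, the per-step reward differences
`r' - r` and the transition-difference terms `(P' - P) ⬝ V^C`. -/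
theorem truncated_value_difference
    {S A : Type*} [Fintype S] [Fintype A] [Nonempty S] [Nonempty A]
    (H : ℕ) (hH : 1 ≤ H) (C : ℝ)
    (r r' : ℕ → S → A → ℝ) (P P' : ℕ → S → A → S → ℝ) (pol : ℕ → S → A → ℝ)
    (hPnonneg : ∀ h s a s', 1 ≤ h → h ≤ H → 0 ≤ P h s a s')
    (hPsum : ∀ h s a, 1 ≤ h → h ≤ H → ∑ s', P h s a s' = 1)
    (hP'nonneg : ∀ h s a s', 1 ≤ h → h ≤ H → 0 ≤ P' h s a s')
    (hP'sum : ∀ h s a, 1 ≤ h → h ≤ H → ∑ s', P' h s a s' = 1)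
    (hpolnonneg : ∀ h s a, 1 ≤ h → h ≤ H → 0 ≤ pol h s a)
    (hpolsum : ∀ h s, 1 ≤ h → h ≤ H → ∑ a, pol h s a = 1)
    (VC V W : ℕ → S → ℝ)
    (hVCend : ∀ s, VC (H + 1) s = 0)
    (hVC : ∀ h, 1 ≤ h → h ≤ H → ∀ s,
      VC h s = ∑ a, pol h s a * min C (r' h s a + ∑ s', P' h s a s' * VC (h + 1) s'))
    (hVend : ∀ s, V (H + 1) s = 0)
    (hV : ∀ h, 1 ≤ h → h ≤ H → ∀ s,
      V h s = ∑ a, pol h s a * (r h s a + ∑ s', P h s a s' * V (h + 1) s'))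
    (hWend : ∀ s, W (H + 1) s = 0)
    (hW : ∀ h, 1 ≤ h → h ≤ H → ∀ s,
      W h s = ∑ a, pol h s a *
        ((r' h s a - r h s a) +
          (∑ s', (P' h s a s' - P h s a s') * VC (h + 1) s') +
          ∑ s', P h s a s' * W (h + 1) s')) :
    ∀ h, 1 ≤ h → h ≤ H + 1 → ∀ s, VC h s - V h s ≤ W h s := by
  intro h h1 hle
  induction hle using Nat.decreasingInduction with
  | self => simp [hVCend, hVend, hWend]
  | of_succ h hlt ih =>
    intro s
    have hh : h ≤ H := Nat.le_of_lt_succ hlt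
    rw [hVC h h1 hh, hV h h1 hh, hW h h1 hh, ← sum_sub_distrib]
    refine sum_le_sum fun a _ => ?_
    rw [← mul_sub]
    refine mul_le_mul_of_nonneg_left ?_ (hpolnonneg h s a h1 hh)
    have hnext : ∑ s', P h s a s' * (VC (h + 1) s' - V (h + 1) s')
        ≤ ∑ s', P h s a s' * W (h + 1) s' :=
      sum_le_sum fun s' _ =>
        mul_le_mul_of_nonneg_left (ih (Nat.le_add_left 1 h) s') (hPnonneg h s a s' h1 hh)
    have hmin := min_le_right C (r' h s a + ∑ s', P' h s a s' * VC (h + 1) s')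
    simp only [mul_sub, sub_mul, sum_sub_distrib] at hnext ⊢
    linarith
end

section
/- Let m, n ≥ 1 be integers, λ > 0 and κ ≥ 1 reals, and let J be a finite index set. For each j ∈ J let A_j be a symmetric positive semidefinite m×m real matrix with A_j − κ^{−1} I_m positive semidefinite, and let d_j ∈ ℝ^n. Then the matrix λ I_{mn} + Σ_{j∈J} A_j ⊗ (d_j d_jᵀ) − κ^{−1} · ( I_m ⊗ ( λ I_n + Σ_{j∈J} d_j d_jᵀ ) ) is positive semidefinite, where ⊗ denotes the Kronecker product of matrices. -/
open Finset Matrix Kronecker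

/-- **Connection between local and global design matrices.** If each per-sample curvature
matrix `A j` is symmetric PSD and dominates `κ⁻¹ I` in the Loewner order (`κ ≥ 1`), then the
regularized Fisher-type matrix `λ I + ∑ j, A j ⊗ d j d jᵀ` dominates `κ⁻¹` times the Kronecker
product of the identity with the regularized Gram matrix `λ I + ∑ j, d j d jᵀ`. -/
theorem local_to_global_design_matrix (m n : ℕ) (hm : 1 ≤ m) (hn : 1 ≤ n)
    (lam κ : ℝ) (hlam : 0 < lam) (hκ : 1 ≤ κ)
    {J : Type*} [Fintype J]
    (A : J → Matrix (Fin m) (Fin m) ℝ) (d : J → Fin n → ℝ)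
    (hA : ∀ j, (A j).PosSemidef)
    (hAκ : ∀ j, (A j - κ⁻¹ • (1 : Matrix (Fin m) (Fin m) ℝ)).PosSemidef) :
    (lam • (1 : Matrix (Fin m × Fin n) (Fin m × Fin n) ℝ) +
        (∑ j, (A j) ⊗ₖ Matrix.vecMulVec (d j) (d j)) -
      κ⁻¹ • ((1 : Matrix (Fin m) (Fin m) ℝ) ⊗ₖ
        (lam • (1 : Matrix (Fin n) (Fin n) ℝ) + ∑ j, Matrix.vecMulVec (d j) (d j)))).PosSemidef
    := by
  have key : lam • (1 : Matrix (Fin m × Fin n) (Fin m × Fin n) ℝ) +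
        (∑ j, (A j) ⊗ₖ Matrix.vecMulVec (d j) (d j)) -
      κ⁻¹ • ((1 : Matrix (Fin m) (Fin m) ℝ) ⊗ₖ
        (lam • (1 : Matrix (Fin n) (Fin n) ℝ) + ∑ j, Matrix.vecMulVec (d j) (d j))) =
      (lam * (1 - κ⁻¹)) • (1 : Matrix (Fin m × Fin n) (Fin m × Fin n) ℝ) +
        ∑ j, (A j - κ⁻¹ • (1 : Matrix (Fin m) (Fin m) ℝ)) ⊗ₖ
          Matrix.vecMulVec (d j) (d j) := by
    rw [kronecker_add, kronecker_smul, one_kronecker_one]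
    ext ⟨i, k⟩ ⟨i', k'⟩
    simp only [Matrix.add_apply, Matrix.sub_apply, Matrix.smul_apply, Matrix.sum_apply,
      kronecker_apply, smul_eq_mul, sub_mul, Finset.sum_sub_distrib, Finset.mul_sum, mul_add,
      mul_assoc]
    ring
  rw [key]
  have hcoef : 0 ≤ lam * (1 - κ⁻¹) :=
    mul_nonneg hlam.le (sub_nonneg.2 (inv_le_one_of_one_le₀ hκ))
  exact (PosSemidef.one.smul hcoef).add <| posSemidef_sum _ fun j _ =>
    (hAκ j).kronecker (by simpa using posSemidef_vecMulVec_self_star (d j))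
end

section
/- Let H ≥ 1 and N ≥ 1 be integers, α ∈ [0,1], and H_α := Σ_{t=0}^{H−1} α^{2t}. Let σ : {1,…,H} → {1,…,N} be injective, let e_j denote the j-th standard basis vector of ℝ^N, and for t ∈ {1,…,H} let d_t := H_α^{−1/2} Σ_{m=1}^{t} α^{t−m} e_{σ(m)}. Let D = Σ_{t=1}^{H} d_t d_tᵀ. Then for every λ > 0 and every h ∈ {1,…,H}: e_{σ(h)}ᵀ ( λ I_N + D )^{−1} e_{σ(h)} ≤ 1 / ( 1/(4 H_α) + λ ). -/
open Finset Matrix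

/-- Effective history horizon `H_α = ∑_{t=0}^{H-1} α^{2t}`. -/
noncomputable def effHorizon (H : ℕ) (α : ℝ) : ℝ := ∑ t ∈ Finset.range H, α ^ (2 * t)

/-- Discounted visitation vector
`d_t = H_α^{-1/2} ∑_{m ≤ t} α^{t-m} e_{σ(m)} ∈ ℝ^N`. -/
noncomputable def discVisit (H N : ℕ) (α : ℝ) (σ : Fin H → Fin N) (t : Fin H) :
    Fin N → ℝ := fun j =>
  (Real.sqrt (effHorizon H α))⁻¹ *
    ∑ m ∈ Finset.Iic t, α ^ ((t : ℕ) - (m : ℕ)) * (if σ m = j then 1 else 0)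

lemma effHorizon_pos {H : ℕ} (hH : 1 ≤ H) (α : ℝ) : 0 < effHorizon H α := by
  have h0 : ∑ t ∈ range 1, α ^ (2 * t) ≤ effHorizon H α :=
    sum_le_sum_of_subset_of_nonneg (range_mono hH) fun t _ _ => by
      rw [pow_mul]; positivity
  simp at h0
  linarith

lemma discVisit_dotProduct (H N : ℕ) (α : ℝ) (σ : Fin H → Fin N) (t : Fin H)
    (y : Fin N → ℝ) :
    discVisit H N α σ t ⬝ᵥ y =
      (Real.sqrt (effHorizon H α))⁻¹ * ∑ m ∈ Iic t, α ^ ((t : ℕ) - (m : ℕ)) * y (σ m) := by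
  simp only [dotProduct, discVisit, mul_assoc, ← mul_sum, sum_mul]
  rw [sum_comm]
  simp

/-- Subtracting `α` times the preceding discounted prefix sum from a discounted prefix sum
recovers the last term. -/
lemma sum_Iic_discount_succ {H : ℕ} (α : ℝ) (f : Fin H → ℝ) {s t : Fin H}
    (hst : (t : ℕ) = s + 1) :
    ∑ m ∈ Iic t, α ^ ((t : ℕ) - (m : ℕ)) * f m =
      f t + α * ∑ m ∈ Iic s, α ^ ((s : ℕ) - (m : ℕ)) * f m := by
  have hI : Iic t = insert t (Iic s) := by
    ext m
    simp only [mem_Iic, mem_insert, Fin.le_def, Fin.ext_iff]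
    omega
  have hts : t ∉ Iic s := by
    simp only [mem_Iic, Fin.le_def]
    omega
  rw [hI, sum_insert hts, mul_sum]
  congr 1
  · simp
  · refine sum_congr rfl fun m hm => ?_
    have hms : (m : ℕ) ≤ s := Fin.le_def.mp (mem_Iic.mp hm)
    rw [hst, Nat.sub_add_comm hms, pow_succ]
    ring

lemma sq_le_four_mul_sum_sq_discount {H : ℕ} {α : ℝ} (hα : α ∈ Set.Icc (0 : ℝ) 1)
    (f : Fin H → ℝ) (h : Fin H) :
    f h ^ 2 ≤ 4 * ∑ t : Fin H, (∑ m ∈ Iic t, α ^ ((t : ℕ) - (m : ℕ)) * f m) ^ 2 := by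
  set S : Fin H → ℝ := fun t => ∑ m ∈ Iic t, α ^ ((t : ℕ) - (m : ℕ)) * f m with hS
  change f h ^ 2 ≤ 4 * ∑ t, S t ^ 2
  rcases Nat.eq_zero_or_pos (h : ℕ) with h0 | hpos
  · have hI : Iic h = {h} := by
      ext m
      simp only [mem_Iic, mem_singleton, Fin.le_def, Fin.ext_iff]
      omega
    have hSh : S h = f h := by simp [hS, hI]
    have hle := single_le_sum (f := fun t => S t ^ 2) (fun t _ => sq_nonneg (S t)) (mem_univ h)
    simp only [hSh] at hle
    nlinarith [sq_nonneg (f h)]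
  · let s : Fin H := ⟨h - 1, by omega⟩
    have hs : (h : ℕ) = s + 1 := by simp only [s]; omega
    have hne : h ≠ s := fun hc => by
      have := congrArg Fin.val hc
      omega
    have hrec : S h = f h + α * S s := sum_Iic_discount_succ α f hs
    have hle : ∑ t ∈ {h, s}, S t ^ 2 ≤ ∑ t, S t ^ 2 :=
      sum_le_sum_of_subset_of_nonneg (subset_univ _) fun t _ _ => sq_nonneg (S t)
    rw [sum_pair hne] at hle
    have hα2 : α ^ 2 ≤ 1 := pow_le_one₀ hα.1 hα.2
    have hf : f h = S h - α * S s := by linarith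
    rw [hf]
    nlinarith [sq_nonneg (S h + α * S s), sq_nonneg (S h), sq_nonneg (S s),
      mul_le_mul_of_nonneg_right hα2 (sq_nonneg (S s))]

lemma dotProduct_sum_vecMulVec_mulVec {ι n : Type*} [Fintype ι] [Fintype n]
    (d : ι → n → ℝ) (y : n → ℝ) :
    y ⬝ᵥ ((∑ t, vecMulVec (d t) (d t)) *ᵥ y) = ∑ t, (d t ⬝ᵥ y) ^ 2 := by
  rw [sum_mulVec, dotProduct_sum]
  refine sum_congr rfl fun t _ => ?_
  rw [vecMulVec_mulVec, dotProduct_smul, dotProduct_comm y]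
  simp [sq]

/-- The single-episode Gram matrix dominates `1 / (4 H_α)` at each visited coordinate. -/
lemma sq_div_le_dotProduct_gram {H N : ℕ} (hH : 1 ≤ H) {α : ℝ} (hα : α ∈ Set.Icc (0 : ℝ) 1)
    (σ : Fin H → Fin N) (h : Fin H) (y : Fin N → ℝ) :
    1 / (4 * effHorizon H α) * y (σ h) ^ 2 ≤
      y ⬝ᵥ ((∑ t, vecMulVec (discVisit H N α σ t) (discVisit H N α σ t)) *ᵥ y) := by
  have hE := effHorizon_pos hH α
  simp only [dotProduct_sum_vecMulVec_mulVec, discVisit_dotProduct, mul_pow, ← mul_sum, inv_pow,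
    Real.sq_sqrt hE.le]
  have hsq := sq_le_four_mul_sum_sq_discount hα (fun m => y (σ m)) h
  calc 1 / (4 * effHorizon H α) * y (σ h) ^ 2
      ≤ 1 / (4 * effHorizon H α) *
        (4 * ∑ t : Fin H, (∑ m ∈ Iic t, α ^ ((t : ℕ) - (m : ℕ)) * y (σ m)) ^ 2) := by gcongr
    _ = _ := by field_simp

/-- If a quadratic form dominates `c` times the square of the `j`-th coordinate, then the `j`-th
diagonal entry of the inverse matrix is at most `1 / c`. -/
lemma single_dotProduct_inv_mulVec_single_le {n : Type*} [Fintype n] [DecidableEq n]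
    (M : Matrix n n ℝ) (j : n) {c : ℝ} (hc : 0 < c)
    (hM : ∀ y, c * y j ^ 2 ≤ y ⬝ᵥ (M *ᵥ y)) :
    Pi.single j (1 : ℝ) ⬝ᵥ (M⁻¹ *ᵥ Pi.single j (1 : ℝ)) ≤ 1 / c := by
  by_cases hdet : IsUnit M.det
  · set y := M⁻¹ *ᵥ Pi.single j (1 : ℝ) with hy
    have hMy : M *ᵥ y = Pi.single j 1 := by
      rw [hy, mulVec_mulVec, mul_nonsing_inv M hdet, one_mulVec]
    have hq := hM y
    rw [hMy, dotProduct_single_one] at hq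
    rw [single_one_dotProduct, le_div_iff₀ hc]
    by_contra! hlt
    have hpos : 0 < y j := pos_of_mul_pos_left (one_pos.trans hlt) hc.le
    nlinarith
  · rw [nonsing_inv_apply_not_isUnit M hdet]
    simp [hc.le]

/-- **Inverse eigenvalues bound.** The diagonal entries of the inverse of the regularized
single-episode Gram matrix, at every coordinate visited during the episode, are bounded by
`1 / (1/(4 H_α) + λ)`. -/
theorem inverse_eigenvalues_bound (H N : ℕ) (hH : 1 ≤ H) (hN : 1 ≤ N)
    (α : ℝ) (hα : α ∈ Set.Icc (0 : ℝ) 1)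
    (σ : Fin H → Fin N) (hσ : Function.Injective σ)
    (D : Matrix (Fin N) (Fin N) ℝ)
    (hD : D = ∑ t, Matrix.vecMulVec (discVisit H N α σ t) (discVisit H N α σ t))
    (lam : ℝ) (hlam : 0 < lam) (h : Fin H) :
    Pi.single (σ h) (1 : ℝ) ⬝ᵥ
        ((lam • (1 : Matrix (Fin N) (Fin N) ℝ) + D)⁻¹ *ᵥ Pi.single (σ h) (1 : ℝ))
      ≤ 1 / (1 / (4 * effHorizon H α) + lam) := by
  have hE := effHorizon_pos hH α
  have hc : 0 < 1 / (4 * effHorizon H α) + lam := by positivity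
  refine single_dotProduct_inv_mulVec_single_le _ _ hc fun y => ?_
  have hy : y (σ h) ^ 2 ≤ y ⬝ᵥ y := by
    rw [dotProduct, sq]
    exact single_le_sum (f := fun i => y i * y i) (fun i _ => mul_self_nonneg _) (mem_univ _)
  rw [add_mulVec, dotProduct_add, smul_mulVec, one_mulVec, dotProduct_smul, smul_eq_mul, hD]
  linarith [sq_div_le_dotProduct_gram hH hα σ h y, mul_le_mul_of_nonneg_left hy hlam.le]
end

section
/- Let H, N, K, M ≥ 1 be integers, α ∈ [0,1], λ > 0, κ ≥ 1, γ ≥ 0, and H_α := Σ_{t=0}^{H−1} α^{2t}. For each k ∈ {1,…,K} let σ_k : {1,…,H} → {1,…,N} be injective and let d_t^k := H_α^{−1/2} Σ_{m=1}^{t} α^{t−m} e_{σ_k(m)} ∈ ℝ^N. Let V = λ I_N + Σ_{k=1}^{K} Σ_{t=1}^{H} d_t^k (d_t^k)ᵀ, and for f = (f_1,…,f_M) ∈ (ℝ^N)^M let 𝐇(f) = λ I_{MN} + Σ_{k=1}^{K} Σ_{t=1}^{H} A(d_t^k, f) ⊗ d_t^k (d_t^k)ᵀ (identifying (ℝ^N)^M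 with ℝ^{MN} blockwise, ⊗ the Kronecker product). Let f*, f̂ ∈ (ℝ^N)^M and assume: (i) A(d_t^k, f*) − κ^{−1} I_M is positive semidefinite for every k, t; and (ii) (f̂ − f*)ᵀ 𝐇(f*) (f̂ − f*) ≤ γ². Then for every i ∈ {1,…,M}, every j ∈ {1,…,N}, and every h ∈ {1,…,H} with n := |{k : σ_k(h) = j}| ≥ 1, the j-th coordinates satisfy |f̂_{i}(j) − f*_{i}(j)| ≤ 2 γ √(κ H_α) / √( n + 4 λ H_α ). -/
open Finset Matrix Kronecker Classical

attribute [local instance] Classical.propDecidable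

/-- Multinomial logistic probability
`z_i(d, f) = exp ⟨f_i, d⟩ / (1 + ∑_m exp ⟨f_m, d⟩)` for `i ∈ {1, …, M}`. -/
noncomputable def mnlProb {M q : ℕ} (d : Fin q → ℝ) (f : Fin M → Fin q → ℝ) (i : Fin M) : ℝ :=
  Real.exp (f i ⬝ᵥ d) / (1 + ∑ m, Real.exp (f m ⬝ᵥ d))

/-- The multinomial logistic curvature matrix
`A(d, f) = diag(z(d,f)) - z(d,f) z(d,f)ᵀ ∈ ℝ^{M×M}`. -/
noncomputable def mnlCurv {M q : ℕ} (d : Fin q → ℝ) (f : Fin M → Fin q → ℝ) :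
    Matrix (Fin M) (Fin M) ℝ :=
  Matrix.diagonal (mnlProb d f) - Matrix.vecMulVec (mnlProb d f) (mnlProb d f)

/-- Blockwise identification of `(ℝ^N)^M` with `ℝ^{M·N}`. -/
def vecFlatten {M N : ℕ} (f : Fin M → Fin N → ℝ) : Fin M × Fin N → ℝ := fun p => f p.1 p.2

lemma one_le_effHorizon {H : ℕ} (hH : 1 ≤ H) {α : ℝ} (hα : 0 ≤ α) : 1 ≤ effHorizon H α := by
  unfold effHorizon
  have := Finset.single_le_sum (f := fun t => α ^ (2 * t)) (fun t _ => pow_nonneg hα _)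
    (Finset.mem_range.2 hH)
  simpa using this

lemma discVisit_zero {H N : ℕ} (α : ℝ) (σ : Fin H → Fin N) (h0 : 0 < H) (j : Fin N) :
    discVisit H N α σ ⟨0, h0⟩ j =
      (Real.sqrt (effHorizon H α))⁻¹ * (Pi.single (σ ⟨0, h0⟩) 1 : Fin N → ℝ) j := by
  have hI : Finset.Iic (⟨0, h0⟩ : Fin H) = {⟨0, h0⟩} := by
    ext m
    simp [Fin.ext_iff, Fin.le_def]
  simp only [discVisit, hI, Finset.sum_singleton, Nat.sub_self, pow_zero, one_mul,
    Pi.single_apply, eq_comm (a := j)]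

lemma discVisit_succ {H N : ℕ} (α : ℝ) (σ : Fin H → Fin N) (s : ℕ) (hs : s + 1 < H) (j : Fin N) :
    discVisit H N α σ ⟨s + 1, hs⟩ j = α * discVisit H N α σ ⟨s, by omega⟩ j +
      (Real.sqrt (effHorizon H α))⁻¹ * (Pi.single (σ ⟨s + 1, hs⟩) 1 : Fin N → ℝ) j := by
  have hI : Finset.Iic (⟨s + 1, hs⟩ : Fin H) =
      insert ⟨s + 1, hs⟩ (Finset.Iic ⟨s, by omega⟩) := by
    ext m
    simp only [Finset.mem_Iic, Finset.mem_insert, Fin.ext_iff, Fin.le_def]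
    omega
  have hsum : ∑ m ∈ Finset.Iic (⟨s, by omega⟩ : Fin H),
        α ^ (s + 1 - (m : ℕ)) * (if σ m = j then (1 : ℝ) else 0) =
      α * ∑ m ∈ Finset.Iic (⟨s, by omega⟩ : Fin H),
        α ^ (s - (m : ℕ)) * (if σ m = j then (1 : ℝ) else 0) := by
    rw [Finset.mul_sum]
    refine Finset.sum_congr rfl fun m hm => ?_
    have hm' : (m : ℕ) ≤ s := by simpa [Fin.le_def] using hm
    rw [Nat.sub_add_comm hm', pow_succ]
    ring
  simp only [discVisit]
  rw [hI, Finset.sum_insert (by simp [Fin.le_def]), hsum]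
  simp only [Nat.sub_self, pow_zero, one_mul, Pi.single_apply, eq_comm (a := j)]
  ring

/-- A coordinate visited at time `h` is controlled by the projections on the visitation vectors. -/
lemma sq_apply_le_sum_dotProduct_discVisit {H N : ℕ} {α : ℝ} (hα : α ∈ Set.Icc (0 : ℝ) 1)
    (σ : Fin H → Fin N) (g : Fin N → ℝ) (h : Fin H) :
    g (σ h) ^ 2 ≤ 2 * effHorizon H α * ∑ t, (g ⬝ᵥ discVisit H N α σ t) ^ 2 := by
  have hE : 0 < effHorizon H α :=
    zero_lt_one.trans_le (one_le_effHorizon (Nat.succ_le_of_lt (Fin.pos h)) hα.1)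
  set c := Real.sqrt (effHorizon H α) with hc
  have hc0 : c ≠ 0 := (Real.sqrt_pos.2 hE).ne'
  have hc2 : c ^ 2 = effHorizon H α := Real.sq_sqrt hE.le
  have key : ∀ x, g (σ h) = c * x → x ^ 2 ≤ 2 * ∑ t, (g ⬝ᵥ discVisit H N α σ t) ^ 2 →
      g (σ h) ^ 2 ≤ 2 * effHorizon H α * ∑ t, (g ⬝ᵥ discVisit H N α σ t) ^ 2 := by
    intro x hx hle
    rw [hx, mul_pow, hc2]
    nlinarith [mul_le_mul_of_nonneg_left hle hE.le]
  obtain ⟨h, hh⟩ := h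
  cases h with
  | zero =>
    have hd : discVisit H N α σ ⟨0, hh⟩ = c⁻¹ • Pi.single (σ ⟨0, hh⟩) 1 := by
      ext j
      simpa using discVisit_zero α σ hh j
    refine key (g ⬝ᵥ discVisit H N α σ ⟨0, hh⟩) ?_ ?_
    · rw [hd, dotProduct_smul, dotProduct_single_one, smul_eq_mul, mul_inv_cancel_left₀ hc0]
    · have h1 := Finset.single_le_sum (f := fun t => (g ⬝ᵥ discVisit H N α σ t) ^ 2)
        (fun t _ => sq_nonneg _) (Finset.mem_univ ⟨0, hh⟩)
      have h2 := sq_nonneg (g ⬝ᵥ discVisit H N α σ ⟨0, hh⟩)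
      linarith
  | succ s =>
    have hs : s < H := by omega
    have hd : discVisit H N α σ ⟨s + 1, hh⟩ =
        α • discVisit H N α σ ⟨s, hs⟩ + c⁻¹ • Pi.single (σ ⟨s + 1, hh⟩) 1 := by
      ext j
      simpa using discVisit_succ α σ s hh j
    refine key (g ⬝ᵥ discVisit H N α σ ⟨s + 1, hh⟩ - α * (g ⬝ᵥ discVisit H N α σ ⟨s, hs⟩)) ?_ ?_
    · rw [hd, dotProduct_add, dotProduct_smul, dotProduct_smul, dotProduct_single_one,
        smul_eq_mul, smul_eq_mul, add_sub_cancel_left, mul_inv_cancel_left₀ hc0]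
    · have h1 := Finset.sum_le_sum_of_subset_of_nonneg
        (f := fun t => (g ⬝ᵥ discVisit H N α σ t) ^ 2)
        (Finset.subset_univ {(⟨s + 1, hh⟩ : Fin H), ⟨s, hs⟩}) (fun t _ _ => sq_nonneg _)
      rw [Finset.sum_pair (by simp [Fin.ext_iff])] at h1
      set x := g ⬝ᵥ discVisit H N α σ ⟨s + 1, hh⟩
      set y := g ⬝ᵥ discVisit H N α σ ⟨s, hs⟩
      have hα2 : α ^ 2 ≤ 1 := pow_le_one₀ hα.1 hα.2
      nlinarith [sq_nonneg (x + α * y), mul_le_mul_of_nonneg_right hα2 (sq_nonneg y)]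

lemma vecFlatten_dotProduct_kronecker_vecMulVec {M N : ℕ} (A : Matrix (Fin M) (Fin M) ℝ)
    (d : Fin N → ℝ) (g : Fin M → Fin N → ℝ) :
    vecFlatten g ⬝ᵥ ((A ⊗ₖ Matrix.vecMulVec d d) *ᵥ vecFlatten g) =
      (fun i => g i ⬝ᵥ d) ⬝ᵥ (A *ᵥ fun i => g i ⬝ᵥ d) := by
  simp only [dotProduct, Matrix.mulVec, vecFlatten, Matrix.kroneckerMap_apply,
    Matrix.vecMulVec_apply, Fintype.sum_prod_type, Finset.mul_sum, Finset.sum_mul]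
  refine Finset.sum_congr rfl fun i _ => ?_
  rw [Finset.sum_comm]
  refine Finset.sum_congr rfl fun i' _ => ?_
  rw [Finset.sum_comm]
  refine Finset.sum_congr rfl fun j' _ => Finset.sum_congr rfl fun j _ => ?_
  ring

lemma smul_sum_sq_le_of_posSemidef_sub {ι : Type*} [Fintype ι] [DecidableEq ι]
    {A : Matrix ι ι ℝ} {c : ℝ} (hA : (A - c • (1 : Matrix ι ι ℝ)).PosSemidef) (x : ι → ℝ) :
    c * ∑ i, x i ^ 2 ≤ x ⬝ᵥ (A *ᵥ x) := by
  have h := hA.dotProduct_mulVec_nonneg x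
  rw [Matrix.sub_mulVec, dotProduct_sub, Matrix.smul_mulVec, Matrix.one_mulVec,
    dotProduct_smul, star_trivial, smul_eq_mul] at h
  simp only [pow_two]
  simpa [dotProduct] using h

/-- **Local estimation confidence bound (deterministic core).** A global `Hmat(f*)`-norm
confidence bound on the estimated feature map, together with a curvature lower bound `κ⁻¹` on
every per-sample matrix `A`, yields a local per-coordinate confidence bound shrinking at rate
`1/√(visit count)`. -/
theorem local_estimation_confidence_bound (H N K M : ℕ)
    (hH : 1 ≤ H) (hN : 1 ≤ N) (hK : 1 ≤ K) (hM : 1 ≤ M)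
    (α : ℝ) (hα : α ∈ Set.Icc (0 : ℝ) 1) (lam : ℝ) (hlam : 0 < lam)
    (κ : ℝ) (hκ : 1 ≤ κ) (γ : ℝ) (hγ : 0 ≤ γ)
    (σ : Fin K → Fin H → Fin N) (hσ : ∀ k, Function.Injective (σ k))
    (fstar fhat : Fin M → Fin N → ℝ)
    (Hmat : Matrix (Fin M × Fin N) (Fin M × Fin N) ℝ)
    (hHmat : Hmat = lam • (1 : Matrix (Fin M × Fin N) (Fin M × Fin N) ℝ) +
      ∑ k, ∑ t, (mnlCurv (discVisit H N α (σ k) t) fstar) ⊗ₖ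
        Matrix.vecMulVec (discVisit H N α (σ k) t) (discVisit H N α (σ k) t))
    (hcurv : ∀ k t, ((mnlCurv (discVisit H N α (σ k) t) fstar) -
      κ⁻¹ • (1 : Matrix (Fin M) (Fin M) ℝ)).PosSemidef)
    (hconf : vecFlatten (fhat - fstar) ⬝ᵥ (Hmat *ᵥ vecFlatten (fhat - fstar)) ≤ γ ^ 2) :
    ∀ (i : Fin M) (j : Fin N) (h : Fin H) (n : ℕ),
      n = ({k : Fin K | σ k h = j} : Finset (Fin K)).card → 1 ≤ n →
      |fhat i j - fstar i j| ≤
        2 * γ * Real.sqrt (κ * effHorizon H α) / Real.sqrt (n + 4 * lam * effHorizon H α) := by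
  intro i j h n hn _
  set g := fhat - fstar with hg
  have hE : 0 < effHorizon H α := zero_lt_one.trans_le (one_le_effHorizon hH hα.1)
  have hκ0 : 0 < κ := zero_lt_one.trans_le hκ
  set S := ∑ k, ∑ t, (g i ⬝ᵥ discVisit H N α (σ k) t) ^ 2 with hS
  have hquad : lam * g i j ^ 2 + κ⁻¹ * S ≤ γ ^ 2 := by
    refine le_trans ?_ hconf
    rw [hHmat, Matrix.add_mulVec, dotProduct_add, Matrix.smul_mulVec, Matrix.one_mulVec,
      dotProduct_smul, smul_eq_mul]
    simp only [Matrix.sum_mulVec, dotProduct_sum, vecFlatten_dotProduct_kronecker_vecMulVec]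
    refine add_le_add (mul_le_mul_of_nonneg_left ?_ hlam.le) ?_
    · have := Finset.single_le_sum (f := fun p => vecFlatten g p * vecFlatten g p)
        (fun p _ => mul_self_nonneg _) (Finset.mem_univ (i, j))
      rw [pow_two]
      exact this
    · rw [hS, Finset.mul_sum]
      refine Finset.sum_le_sum fun k _ => ?_
      rw [Finset.mul_sum]
      refine Finset.sum_le_sum fun t _ => ?_
      refine le_trans ?_ (smul_sum_sq_le_of_posSemidef_sub (by convert hcurv k t) _)
      exact mul_le_mul_of_nonneg_left
        (Finset.single_le_sum (f := fun i => (g i ⬝ᵥ discVisit H N α (σ k) t) ^ 2)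
          (fun _ _ => sq_nonneg _) (Finset.mem_univ i)) (inv_pos.2 hκ0).le
  have hcount : n * g i j ^ 2 ≤ 2 * effHorizon H α * S := by
    rw [hn, ← nsmul_eq_mul, ← Finset.sum_const, hS, Finset.mul_sum]
    refine (Finset.sum_le_sum fun k hk => ?_).trans
      (Finset.sum_le_sum_of_subset_of_nonneg (Finset.subset_univ _) fun k _ _ => by positivity)
    rw [← (Finset.mem_filter.1 hk).2]
    exact sq_apply_le_sum_dotProduct_discVisit hα (σ k) (g i) h
  have hS0 : 0 ≤ S := by positivity
  have hsum : lam * g i j ^ 2 + S ≤ κ * γ ^ 2 := by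
    have h1 := mul_le_mul_of_nonneg_left hquad hκ0.le
    rw [mul_add, mul_inv_cancel_left₀ hκ0.ne'] at h1
    have h2 : lam * g i j ^ 2 ≤ κ * (lam * g i j ^ 2) :=
      le_mul_of_one_le_left (by positivity) hκ
    linarith
  have hD : 0 < (n : ℝ) + 4 * lam * effHorizon H α := by positivity
  rw [le_div_iff₀ (Real.sqrt_pos.2 hD)]
  refine abs_le_of_sq_le_sq' ?_ (by positivity) |>.2
  rw [mul_pow, mul_pow, mul_pow, sq_abs, Real.sq_sqrt hD.le,
    Real.sq_sqrt (by positivity : 0 ≤ κ * effHorizon H α)]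
  change g i j ^ 2 * _ ≤ _
  nlinarith [mul_le_mul_of_nonneg_left hsum hE.le, mul_nonneg hE.le hS0]
end
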